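/- For every element w of a finite Weyl group W acting on an n-dimensional Euclidean space V, the reflection length of w satisfies l_Δ(w) = n − dim Ker(w − 1). -/

import Mathlib

set_option linter.unusedSectionVars false

open scoped RealInnerProductSpace
open Module

variable {V : Type*} [NormedAddCommGroup V] [InnerProductSpace ℝ V] [FiniteDimensional ℝ V]

/-- The reflection in the hyperplane orthogonal to `γ` (the identity if `γ = 0`). -/
noncomputable def srefl (γ : V) : V →ₗ[ℝ] V :=
  LinearMap.id - (LinearMap.toSpanSingleton ℝ V ((2 / ⟪γ, γ⟫) • γ)).comp (innerSL ℝ γ).toLinearMap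

lemma srefl_apply (γ x : V) : srefl γ x = x - (2 * ⟪γ, x⟫ / ⟪γ, γ⟫) • γ := by
  simp [srefl, LinearMap.toSpanSingleton, smul_smul]
  ring_nf

lemma srefl_involutive (γ : V) : Function.Involutive (srefl γ) := by
  intro x
  rcases eq_or_ne γ 0 with h | h
  · simp [srefl_apply, h]
  · have hγ : ⟪γ, γ⟫ ≠ 0 := fun hc => h (inner_self_eq_zero.mp hc)
    rw [srefl_apply, srefl_apply, inner_sub_right, real_inner_smul_right]
    field_simp
    ring_nf
    module

/-- The reflection in `γ` as a linear automorphism of `V`. -/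
noncomputable def sref (γ : V) : V ≃ₗ[ℝ] V :=
  { srefl γ with
    invFun := srefl γ
    left_inv := srefl_involutive γ
    right_inv := srefl_involutive γ }

/-- A finite reduced crystallographic root system spanning `V`. -/
structure IsRootSystem (Δ : Set V) : Prop where
  finite : Δ.Finite
  nonzero : (0 : V) ∉ Δ
  span_top : Submodule.span ℝ Δ = ⊤
  refl_mem : ∀ γ ∈ Δ, ∀ β ∈ Δ, sref γ β ∈ Δ
  crystallographic : ∀ γ ∈ Δ, ∀ β ∈ Δ, ∃ m : ℤ, 2 * ⟪β, γ⟫ / ⟪γ, γ⟫ = (m : ℝ)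
  reduced : ∀ γ ∈ Δ, ∀ t : ℝ, t • γ ∈ Δ → t = 1 ∨ t = -1

/-- The Weyl group: the subgroup of `GL(V)` generated by the reflections in the roots. -/
def weylGroup (Δ : Set V) : Subgroup (V ≃ₗ[ℝ] V) :=
  Subgroup.closure {g | ∃ γ ∈ Δ, g = sref γ}

/-- The reflection length of `w`: the least number of reflections in roots whose
product is `w`. -/
noncomputable def reflLength (Δ : Set V) (w : V ≃ₗ[ℝ] V) : ℕ :=
  sInf {r | ∃ γ : Fin r → V, (∀ i, γ i ∈ Δ) ∧ w = (List.ofFn fun i => sref (γ i)).prod}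

/-- A base (system of simple roots `α` with positive roots `Pos`) for the root system `Δ`. -/
structure IsBase (Δ Pos : Set V) {n : ℕ} (α : Fin n → V) : Prop where
  pos_subset : Pos ⊆ Δ
  simple_mem : ∀ i, α i ∈ Pos
  mem_or_neg : ∀ γ ∈ Δ, γ ∈ Pos ∨ -γ ∈ Pos
  not_neg : ∀ γ ∈ Pos, -γ ∉ Pos
  pos_combo : ∀ γ ∈ Pos, ∃ c : Fin n → ℕ, γ = ∑ j, (c j : ℝ) • α j

/-- `l` is a word (in the simple reflections) for `w`. -/
def IsWord {n : ℕ} (α : Fin n → V) (l : List (Fin n)) (w : V ≃ₗ[ℝ] V) : Prop :=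
  (l.map fun j => sref (α j)).prod = w

/-- The Coxeter length of `w` with respect to the simple system `α`. -/
noncomputable def len {n : ℕ} (α : Fin n → V) (w : V ≃ₗ[ℝ] V) : ℕ :=
  sInf {r | ∃ l : List (Fin n), IsWord α l w ∧ l.length = r}

/-- Bruhat order: `v ≤ w` iff some reduced word for `w` has a subword with value `v`. -/
def bruhatLE {n : ℕ} (α : Fin n → V) (v w : V ≃ₗ[ℝ] V) : Prop :=
  ∃ l : List (Fin n), IsWord α l w ∧ l.length = len α w ∧
    ∃ l' : List (Fin n), l'.Sublist l ∧ IsWord α l' v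

/-- The product of the simple reflections indexed by a word given as a function
`i : Fin m → Fin n`, along a list of positions. -/
noncomputable def fwordProd {n m : ℕ} (α : Fin n → V) (i : Fin m → Fin n)
    (l : List (Fin m)) : V ≃ₗ[ℝ] V :=
  (l.map fun j => sref (α (i j))).prod

/-- The full product `s_{i₁} ⋯ s_{i_m}`. -/
noncomputable def fullProd {n m : ℕ} (α : Fin n → V) (i : Fin m → Fin n) : V ≃ₗ[ℝ] V :=
  fwordProd α i (List.finRange m)

/-- The root `β_k = s_{i₁} ⋯ s_{i_{k-1}} (α_{i_k})` associated to the `k`-th position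
of the word `i` (positions indexed from `0`). -/
noncomputable def betaRoot {n m : ℕ} (α : Fin n → V) (i : Fin m → Fin n) (k : Fin m) : V :=
  fwordProd α i ((List.finRange m).take k) (α (i k))

/-- The value of the subword of `i` obtained by deleting the positions `p t`. -/
noncomputable def complProd {n m d : ℕ} (α : Fin n → V) (i : Fin m → Fin n)
    (p : Fin d → Fin m) : V ≃ₗ[ℝ] V :=
  fwordProd α i ((List.finRange m).filter fun j => ∀ t, p t ≠ j)

/-- A linear automorphism preserving the inner product. -/
def PreservesInner (g : V ≃ₗ[ℝ] V) : Prop :=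
  ∀ x y, ⟪g x, g y⟫ = ⟪x, y⟫

/-- The product of the reflections in the vectors of a list. -/
noncomputable def reflProd (l : List V) : V ≃ₗ[ℝ] V :=
  (l.map sref).prod

lemma sref_apply (γ x : V) : sref γ x = x - (2 * ⟪γ, x⟫ / ⟪γ, γ⟫) • γ :=
  srefl_apply γ x

lemma sref_apply_self {γ : V} (h : γ ≠ 0) : sref γ γ = -γ := by
  have hγ : ⟪γ, γ⟫ ≠ 0 := fun hc => h (inner_self_eq_zero.mp hc)
  rw [sref_apply, mul_div_assoc, div_self hγ]
  module

lemma sref_apply_of_inner_eq_zero {γ x : V} (h : ⟪γ, x⟫ = 0) : sref γ x = x := by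
  simp [sref_apply, h]

lemma sref_mul_self (γ : V) : sref γ * sref γ = 1 :=
  LinearEquiv.ext fun x => srefl_involutive γ x

lemma sref_inv (γ : V) : (sref γ)⁻¹ = sref γ :=
  inv_eq_of_mul_eq_one_left (sref_mul_self γ)

lemma sref_neg (γ : V) : sref (-γ) = sref γ := by
  ext x
  simp [sref_apply]
  ring_nf
  module

lemma preservesInner_sref (γ : V) : PreservesInner (sref γ) := by
  intro x y
  rcases eq_or_ne γ 0 with h | h
  · simp [sref_apply, h]
  · have hγ : ⟪γ, γ⟫ ≠ 0 := fun hc => h (inner_self_eq_zero.mp hc)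
    simp only [sref_apply, inner_sub_left, inner_sub_right, real_inner_smul_left,
      real_inner_smul_right, real_inner_comm γ x]
    field_simp
    ring

lemma sref_map {g : V ≃ₗ[ℝ] V} (hg : PreservesInner g) (γ : V) :
    sref (g γ) * g = g * sref γ := by
  ext x
  simp only [LinearEquiv.mul_apply, sref_apply, hg γ x, hg γ γ, map_sub, map_smul]

lemma reflProd_cons (γ : V) (l : List V) : reflProd (γ :: l) = sref γ * reflProd l := by
  simp [reflProd]

lemma reflProd_append (l l' : List V) : reflProd (l ++ l') = reflProd l * reflProd l' := by
  simp [reflProd]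

lemma preservesInner_reflProd (l : List V) : PreservesInner (reflProd l) := by
  induction l with
  | nil => intro x y; simp [reflProd]
  | cons γ l ih =>
    intro x y
    rw [reflProd_cons, LinearEquiv.mul_apply, LinearEquiv.mul_apply, preservesInner_sref, ih]

/-- If `x` and `x + γ` have the same norm, then the reflection in `γ` exchanges them. -/
lemma sref_add_of_inner_self_eq {γ x : V} (hγ : γ ≠ 0) (h : ⟪x + γ, x + γ⟫ = ⟪x, x⟫) :
    sref γ (x + γ) = x := by
  have h0 : ⟪γ, γ⟫ ≠ 0 := fun hc => hγ (inner_self_eq_zero.mp hc)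
  have h1 : 2 * ⟪γ, x + γ⟫ = ⟪γ, γ⟫ := by
    simp only [inner_add_left, inner_add_right, real_inner_comm γ x] at h ⊢
    linarith
  rw [sref_apply, h1, div_self h0]
  module

/-- The image of `g - 1` is the orthogonal complement of the fixed space of `g`. -/
lemma mem_range_sub_one {g : V ≃ₗ[ℝ] V} (hg : PreservesInner g) {γ : V}
    (hγ : ∀ u, g u = u → ⟪γ, u⟫ = 0) : ∃ x, g x = x + γ := by
  have hmem : γ ∈ LinearMap.range ((↑g : V →ₗ[ℝ] V) - 1) := by
    rw [← Submodule.orthogonal_orthogonal (LinearMap.range _), Submodule.mem_orthogonal']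
    intro y hy
    refine hγ y ?_
    have h1 : ⟪y, g y - y⟫ = 0 :=
      (Submodule.mem_orthogonal' _ _).mp hy _ ⟨y, by simp⟩
    rw [← sub_eq_zero, ← inner_self_eq_zero (𝕜 := ℝ)]
    have h2 := hg y y
    simp only [inner_sub_left, inner_sub_right, real_inner_comm y (g y)] at h1 ⊢
    linarith
  obtain ⟨x, hx⟩ := hmem
  exact ⟨x, by rw [← hx]; simp⟩

lemma finrank_range_reflProd_sub_one_le (l : List V) :
    finrank ℝ (LinearMap.range ((↑(reflProd l) : V →ₗ[ℝ] V) - 1)) ≤ l.length := by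
  induction l with
  | nil =>
    have h : ((↑(reflProd ([] : List V)) : V →ₗ[ℝ] V) - 1) = 0 := by
      ext x
      simp [reflProd]
    rw [h]
    simp
  | cons γ l ih =>
    have hle : LinearMap.range ((↑(reflProd (γ :: l)) : V →ₗ[ℝ] V) - 1) ≤
        LinearMap.range ((↑(reflProd l) : V →ₗ[ℝ] V) - 1) ⊔ Submodule.span ℝ {γ} := by
      rintro _ ⟨x, rfl⟩
      refine Submodule.mem_sup.mpr ⟨_, ⟨x, rfl⟩, _,
        Submodule.smul_mem _ (-(2 * ⟪γ, reflProd l x⟫ / ⟪γ, γ⟫))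
          (Submodule.mem_span_singleton_self γ), ?_⟩
      simp [reflProd_cons, sref_apply]
      module
    calc _ ≤ _ := Submodule.finrank_mono hle
      _ ≤ _ := Submodule.finrank_add_le_finrank_add_finrank _ _
      _ ≤ l.length + 1 := add_le_add ih (by simpa using finrank_span_le_card (R := ℝ) {γ})
      _ = _ := rfl

/-- The roots on the positive side of the hyperplane orthogonal to `u`. -/
def posRoots (Δ : Set V) (u : V) : Set V :=
  {γ | γ ∈ Δ ∧ 0 < ⟪γ, u⟫}

/-- The positive roots that are not sums of two positive roots. -/
def simpleRoots (Δ : Set V) (u : V) : Set V :=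
  {α | α ∈ posRoots Δ u ∧ ∀ β ∈ posRoots Δ u, ∀ γ ∈ posRoots Δ u, β + γ ≠ α}

namespace IsRootSystem

variable {Δ : Set V}

lemma ne_zero (hΔ : IsRootSystem Δ) {γ : V} (hγ : γ ∈ Δ) : γ ≠ 0 :=
  fun h => hΔ.nonzero (h ▸ hγ)

lemma neg_mem (hΔ : IsRootSystem Δ) {γ : V} (hγ : γ ∈ Δ) : -γ ∈ Δ := by
  rw [← sref_apply_self (hΔ.ne_zero hγ)]
  exact hΔ.refl_mem γ hγ γ hγ

/-- Distinct roots at an acute angle differ by a root. -/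
lemma sub_mem (hΔ : IsRootSystem Δ) {α β : V} (hα : α ∈ Δ) (hβ : β ∈ Δ) (hne : α ≠ β)
    (hpos : 0 < ⟪α, β⟫) : α - β ∈ Δ := by
  have hα0 := hΔ.ne_zero hα
  have hβ0 := hΔ.ne_zero hβ
  have hαα : 0 < ⟪α, α⟫ := real_inner_self_pos.mpr hα0
  have hββ : 0 < ⟪β, β⟫ := real_inner_self_pos.mpr hβ0
  obtain ⟨m, hm⟩ := hΔ.crystallographic β hβ α hα
  obtain ⟨k, hk⟩ := hΔ.crystallographic α hα β hβ
  have hcomm := real_inner_comm α β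
  have hm0 : 0 < m := by
    have : (0 : ℝ) < m := by rw [← hm]; positivity
    exact_mod_cast this
  have hk0 : 0 < k := by
    have : (0 : ℝ) < k := by rw [← hk, hcomm]; positivity
    exact_mod_cast this
  by_cases hm1 : m = 1
  · have h := hΔ.refl_mem β hβ α hα
    rwa [sref_apply, hcomm, hm, hm1, Int.cast_one, one_smul] at h
  by_cases hk1 : k = 1
  · have h := hΔ.neg_mem (hΔ.refl_mem α hα β hβ)
    rwa [sref_apply, ← hcomm, hk, hk1, Int.cast_one, one_smul, neg_sub] at h
  exfalso
  have hm2 : (2 : ℝ) ≤ m := by exact_mod_cast (by omega : 2 ≤ m)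
  have hk2 : (2 : ℝ) ≤ k := by exact_mod_cast (by omega : 2 ≤ k)
  rw [← hm, le_div_iff₀ hββ] at hm2
  rw [← hk, le_div_iff₀ hαα, hcomm] at hk2
  have h : ⟪α - β, α - β⟫ ≤ 0 := by
    simp only [inner_sub_left, inner_sub_right, hcomm]
    linarith
  exact hne (sub_eq_zero.mp (real_inner_self_nonpos.mp h))

/-- Induction on the height `⟪β, u⟫` of a positive root. -/
lemma posRoots_induction (hΔ : IsRootSystem Δ) {u : V} {P : V → Prop}
    (h : ∀ β ∈ posRoots Δ u, (∀ γ ∈ posRoots Δ u, ⟪γ, u⟫ < ⟪β, u⟫ → P γ) → P β) :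
    ∀ β ∈ posRoots Δ u, P β := by
  by_contra! hc
  obtain ⟨β₀, hβ₀, hP₀⟩ := hc
  have hfin : {β | β ∈ posRoots Δ u ∧ ¬ P β}.Finite := hΔ.finite.subset fun _ hβ => hβ.1.1
  obtain ⟨β, ⟨hβ, hP⟩, hmin⟩ :=
    Set.exists_min_image _ (fun β => ⟪β, u⟫) hfin ⟨β₀, hβ₀, hP₀⟩
  refine hP (h β hβ fun γ hγ hlt => ?_)
  by_contra hPγ
  exact absurd (hmin γ ⟨hγ, hPγ⟩) (not_le.mpr hlt)

variable {u : V}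

lemma neg_mem_posRoots (hΔ : IsRootSystem Δ) (hu : ∀ γ ∈ Δ, ⟪γ, u⟫ ≠ 0) {γ : V} (hγ : γ ∈ Δ)
    (hpos : γ ∉ posRoots Δ u) : -γ ∈ posRoots Δ u := by
  refine ⟨hΔ.neg_mem hγ, ?_⟩
  rw [inner_neg_left]
  have h1 : ¬ 0 < ⟪γ, u⟫ := fun h => hpos ⟨hγ, h⟩
  have h2 := lt_of_le_of_ne (not_lt.mp h1) (hu γ hγ)
  linarith

lemma sub_mem_posRoots (hΔ : IsRootSystem Δ) (hu : ∀ γ ∈ Δ, ⟪γ, u⟫ ≠ 0) {α β : V}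
    (hα : α ∈ simpleRoots Δ u) (hβ : β ∈ posRoots Δ u) (h : β - α ∈ Δ) :
    β - α ∈ posRoots Δ u := by
  by_contra hc
  exact hα.2 β hβ _ (hΔ.neg_mem_posRoots hu h hc) (by abel)

/-- The reflection in a simple root permutes the other positive roots. -/
lemma sref_mem_posRoots (hΔ : IsRootSystem Δ) (hu : ∀ γ ∈ Δ, ⟪γ, u⟫ ≠ 0) {α : V}
    (hα : α ∈ simpleRoots Δ u) :
    ∀ β ∈ posRoots Δ u, β ≠ α → sref α β ∈ posRoots Δ u := by
  have hα0 := hΔ.ne_zero hα.1.1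
  have hαα : 0 < ⟪α, α⟫ := real_inner_self_pos.mpr hα0
  refine hΔ.posRoots_induction fun β hβ ih hne => ?_
  have hmem := hΔ.refl_mem α hα.1.1 β hβ.1
  rcases le_or_gt ⟪β, α⟫ 0 with hle | hpos
  · refine ⟨hmem, ?_⟩
    rw [sref_apply, inner_sub_left, real_inner_smul_left, real_inner_comm β α]
    have h1 : 2 * ⟪β, α⟫ / ⟪α, α⟫ ≤ 0 := div_nonpos_of_nonpos_of_nonneg (by linarith) hαα.le
    have h2 := mul_nonpos_of_nonpos_of_nonneg h1 hα.1.2.le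
    linarith [hβ.2]
  · have hsub := hΔ.sub_mem_posRoots hu hα hβ (hΔ.sub_mem hβ.1 hα.1.1 hne hpos)
    have hne' : β - α ≠ α := by
      intro h
      have h2 : (2 : ℝ) • α = β := by
        rw [two_smul]
        nth_rewrite 1 [← h]
        abel
      have := hΔ.reduced α hα.1.1 2 (h2 ▸ hβ.1)
      norm_num at this
    have hlt : ⟪β - α, u⟫ < ⟪β, u⟫ := by
      rw [inner_sub_left]
      linarith [hα.1.2]
    have heq : sref α (β - α) - α = sref α β := by
      rw [map_sub, sref_apply_self hα0]
      abel
    rw [← heq]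
    exact hΔ.sub_mem_posRoots hu hα (ih _ hsub hlt hne') (heq ▸ hmem)

lemma mem_closure_simpleRoots (hΔ : IsRootSystem Δ) :
    ∀ β ∈ posRoots Δ u, β ∈ AddSubmonoid.closure (simpleRoots Δ u) := by
  refine hΔ.posRoots_induction fun β hβ ih => ?_
  by_cases hs : β ∈ simpleRoots Δ u
  · exact AddSubmonoid.subset_closure hs
  · have h : ∃ γ ∈ posRoots Δ u, ∃ δ ∈ posRoots Δ u, γ + δ = β := by
      by_contra! hc
      exact hs ⟨hβ, hc⟩
    obtain ⟨γ, hγ, δ, hδ, rfl⟩ := h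
    rw [inner_add_left] at ih
    exact add_mem (ih γ hγ (by linarith [hδ.2])) (ih δ hδ (by linarith [hγ.2]))

lemma exists_simpleRoot_inner_pos (hΔ : IsRootSystem Δ) {β : V} (hβ : β ∈ posRoots Δ u) :
    ∃ α ∈ simpleRoots Δ u, 0 < ⟪β, α⟫ := by
  by_contra! hc
  have h : ∀ x ∈ AddSubmonoid.closure (simpleRoots Δ u), ⟪β, x⟫ ≤ 0 := by
    intro x hx
    induction hx using AddSubmonoid.closure_induction with
    | mem x hx => exact hc x hx
    | zero => simp
    | add x y _ _ hx hy =>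
      rw [inner_add_right]
      linarith
  have h1 := h β (hΔ.mem_closure_simpleRoots β hβ)
  exact absurd (real_inner_self_pos.mpr (hΔ.ne_zero hβ.1)) (not_lt.mpr h1)

/-- The reflection in a positive root is a product of simple reflections. -/
lemma exists_reflProd_eq_sref_of_pos (hΔ : IsRootSystem Δ) (hu : ∀ γ ∈ Δ, ⟪γ, u⟫ ≠ 0) :
    ∀ β ∈ posRoots Δ u, ∃ l : List V, (∀ γ ∈ l, γ ∈ simpleRoots Δ u) ∧ reflProd l = sref β := by
  refine hΔ.posRoots_induction fun β hβ ih => ?_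
  by_cases hs : β ∈ simpleRoots Δ u
  · exact ⟨[β], by simpa using hs, by simp [reflProd]⟩
  obtain ⟨α, hα, hpos⟩ := hΔ.exists_simpleRoot_inner_pos hβ
  have hαα : 0 < ⟪α, α⟫ := real_inner_self_pos.mpr (hΔ.ne_zero hα.1.1)
  have hlt : ⟪sref α β, u⟫ < ⟪β, u⟫ := by
    rw [sref_apply, inner_sub_left, real_inner_smul_left, real_inner_comm β α]
    have h1 : 0 < 2 * ⟪β, α⟫ / ⟪α, α⟫ := by positivity
    linarith [mul_pos h1 hα.1.2]
  obtain ⟨l, hl, hprod⟩ :=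
    ih _ (hΔ.sref_mem_posRoots hu hα β hβ fun h => hs (h ▸ hα)) hlt
  refine ⟨α :: (l ++ [α]), ?_, ?_⟩
  · intro γ hγ
    simp only [List.mem_cons, List.mem_append, List.not_mem_nil, or_false] at hγ
    rcases hγ with rfl | hγ | rfl
    exacts [hα, hl γ hγ, hα]
  · rw [reflProd_cons, reflProd_append, hprod, reflProd_cons]
    simp only [reflProd, List.map_nil, List.prod_nil, mul_one]
    rw [sref_map (preservesInner_sref α), ← mul_assoc, sref_mul_self, one_mul]

lemma exists_reflProd_eq_sref (hΔ : IsRootSystem Δ) (hu : ∀ γ ∈ Δ, ⟪γ, u⟫ ≠ 0) {β : V}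
    (hβ : β ∈ Δ) : ∃ l : List V, (∀ γ ∈ l, γ ∈ simpleRoots Δ u) ∧ reflProd l = sref β := by
  by_cases hpos : β ∈ posRoots Δ u
  · exact hΔ.exists_reflProd_eq_sref_of_pos hu β hpos
  · rw [← sref_neg]
    exact hΔ.exists_reflProd_eq_sref_of_pos hu _ (hΔ.neg_mem_posRoots hu hβ hpos)

/-- A product of root reflections is a product of simple reflections. -/
lemma exists_simple_reflProd_eq (hΔ : IsRootSystem Δ) (hu : ∀ γ ∈ Δ, ⟪γ, u⟫ ≠ 0) {l : List V}
    (hl : ∀ γ ∈ l, γ ∈ Δ) :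
    ∃ l' : List V, (∀ γ ∈ l', γ ∈ simpleRoots Δ u) ∧ reflProd l' = reflProd l := by
  induction l with
  | nil => exact ⟨[], by simp, rfl⟩
  | cons γ l ih =>
    obtain ⟨l₁, h₁, e₁⟩ := hΔ.exists_reflProd_eq_sref hu (hl γ (by simp))
    obtain ⟨l₂, h₂, e₂⟩ := ih fun δ hδ => hl δ (by simp [hδ])
    refine ⟨l₁ ++ l₂, fun δ hδ => ?_, by rw [reflProd_append, e₁, e₂, reflProd_cons]⟩
    exact (List.mem_append.mp hδ).elim (h₁ δ) (h₂ δ)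

/-- If a product of simple reflections makes the positive root `β` negative, then some suffix of
the product maps `β` to the simple root preceding that suffix. -/
lemma exists_reflProd_apply_eq (hΔ : IsRootSystem Δ) (hu : ∀ γ ∈ Δ, ⟪γ, u⟫ ≠ 0) {β : V}
    (hβ : β ∈ posRoots Δ u) {l : List V} (hl : ∀ γ ∈ l, γ ∈ simpleRoots Δ u)
    (hneg : reflProd l β ∉ posRoots Δ u) :
    ∃ l₁ l₂ : List V, l = l₁ ++ reflProd l₂ β :: l₂ := by
  induction l with
  | nil => exact absurd (by simpa [reflProd] using hβ) hneg
  | cons α l ih =>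
    have hl' : ∀ γ ∈ l, γ ∈ simpleRoots Δ u := fun γ hγ => hl γ (by simp [hγ])
    by_cases hpos : reflProd l β ∈ posRoots Δ u
    · refine ⟨[], l, ?_⟩
      by_contra hne
      refine hneg ?_
      rw [reflProd_cons, LinearEquiv.mul_apply]
      exact hΔ.sref_mem_posRoots hu (hl α (by simp)) _ hpos fun h => hne (by simp [h])
    · obtain ⟨l₁, l₂, h⟩ := ih hl' hpos
      exact ⟨α :: l₁, l₂, by simpa using h⟩

/-- A product of simple reflections fixing a vector orthogonal to no root is trivial. -/
lemma simple_reflProd_eq_one (hΔ : IsRootSystem Δ) (hu : ∀ γ ∈ Δ, ⟪γ, u⟫ ≠ 0) (n : ℕ) :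
    ∀ l : List V, l.length = n → (∀ γ ∈ l, γ ∈ simpleRoots Δ u) → reflProd l u = u →
      reflProd l = 1 := by
  induction n using Nat.strong_induction_on with
  | _ n ih =>
    intro l hn hl hfix
    rcases List.eq_nil_or_concat' l with rfl | ⟨l', β, rfl⟩
    · simp [reflProd]
    have hβ : β ∈ simpleRoots Δ u := hl β (by simp)
    have hl' : ∀ γ ∈ l', γ ∈ simpleRoots Δ u := fun γ hγ => hl γ (by simp [hγ])
    have hsplit : reflProd (l' ++ [β]) = reflProd l' * sref β := by
      simp [reflProd]
    have hneg : reflProd l' β ∉ posRoots Δ u := by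
      intro hpos
      have h1 := preservesInner_reflProd (l' ++ [β]) β u
      rw [hfix, hsplit, LinearEquiv.mul_apply, sref_apply_self (hΔ.ne_zero hβ.1.1), map_neg,
        inner_neg_left] at h1
      linarith [hpos.2, hβ.1.2]
    obtain ⟨l₁, l₂, h⟩ := hΔ.exists_reflProd_apply_eq hu hβ.1 hl' hneg
    have hprod : reflProd (l' ++ [β]) = reflProd (l₁ ++ l₂) := by
      rw [hsplit, h, reflProd_append, reflProd_cons, sref_map (preservesInner_reflProd l₂),
        mul_assoc, mul_assoc, sref_mul_self, mul_one, reflProd_append]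
    rw [hprod] at hfix ⊢
    refine ih _ ?_ (l₁ ++ l₂) rfl (fun γ hγ => hl' γ ?_) hfix
    · have := congrArg List.length h
      simp at this hn ⊢
      omega
    · rw [h]
      simp only [List.mem_append, List.mem_cons] at hγ ⊢
      tauto

/-- A nontrivial element of the Weyl group has a root orthogonal to its fixed space. -/
lemma exists_root_orthogonal_fixed (hΔ : IsRootSystem Δ) {l : List V} (hl : ∀ γ ∈ l, γ ∈ Δ)
    (hne : reflProd l ≠ 1) : ∃ γ ∈ Δ, ∀ u, reflProd l u = u → ⟪γ, u⟫ = 0 := by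
  by_contra! hc
  have := hΔ.finite.to_subtype
  obtain ⟨u, hfix, hu⟩ := Module.Dual.exists_forall_mem_ne_zero_of_forall_exists
    (LinearMap.ker ((↑(reflProd l) : V →ₗ[ℝ] V) - 1))
    (fun γ : Δ => (innerSL ℝ (γ : V)).toLinearMap) (fun γ => by
      obtain ⟨u, hu, h0⟩ := hc γ γ.2
      exact ⟨u, by simp [hu], by simpa using h0⟩)
  replace hfix : reflProd l u = u := by simpa [sub_eq_zero] using hfix
  replace hu : ∀ γ ∈ Δ, ⟪γ, u⟫ ≠ 0 := fun γ hγ => by simpa using hu ⟨γ, hγ⟩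
  obtain ⟨l', hl', heq⟩ := hΔ.exists_simple_reflProd_eq hu hl
  exact hne (heq ▸ hΔ.simple_reflProd_eq_one hu _ l' rfl hl' (heq ▸ hfix))

/-- Every product of root reflections can be rewritten with at most as many root reflections as
the codimension of its fixed space. -/
lemma exists_reflProd_eq_length_add_finrank_le (hΔ : IsRootSystem Δ) (n : ℕ) :
    ∀ l : List V, (∀ γ ∈ l, γ ∈ Δ) →
      finrank ℝ V ≤ n + finrank ℝ (LinearMap.ker ((↑(reflProd l) : V →ₗ[ℝ] V) - 1)) →
      ∃ l' : List V, (∀ γ ∈ l', γ ∈ Δ) ∧ reflProd l' = reflProd l ∧ l'.length ≤ n := by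
  induction n with
  | zero =>
    intro l _ hn
    have hker := Submodule.eq_top_of_finrank_eq
      (le_antisymm (Submodule.finrank_le _) (by simpa using hn))
    refine ⟨[], by simp, ?_, by simp⟩
    have h1 := sub_eq_zero.mp (LinearMap.ker_eq_top.mp hker)
    ext x
    simpa [reflProd] using (LinearMap.congr_fun h1 x).symm
  | succ n ih =>
    intro l hl hn
    by_cases hone : reflProd l = 1
    · exact ⟨[], by simp, by rw [hone]; rfl, by simp⟩
    obtain ⟨γ, hγ, horth⟩ := hΔ.exists_root_orthogonal_fixed hl hone
    obtain ⟨x, hx⟩ := mem_range_sub_one (preservesInner_reflProd l) horth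
    have hγ0 := hΔ.ne_zero hγ
    have hfix : reflProd (γ :: l) x = x := by
      rw [reflProd_cons, LinearEquiv.mul_apply, hx]
      exact sref_add_of_inner_self_eq hγ0 (by rw [← hx, preservesInner_reflProd])
    have hlt : LinearMap.ker ((↑(reflProd l) : V →ₗ[ℝ] V) - 1) <
        LinearMap.ker ((↑(reflProd (γ :: l)) : V →ₗ[ℝ] V) - 1) := by
      refine SetLike.lt_iff_le_and_exists.mpr ⟨fun y hy => ?_, x, ?_, ?_⟩
      · have hy' : reflProd l y = y := by simpa [sub_eq_zero] using hy
        simp [reflProd_cons, hy', sref_apply_of_inner_eq_zero (horth y hy')]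
      · simp [hfix]
      · simpa [hx] using hγ0
    have hdim := Submodule.finrank_lt_finrank_of_lt hlt
    obtain ⟨l', hl', heq, hlen⟩ := ih (γ :: l) (by simpa using ⟨hγ, hl⟩) (by omega)
    refine ⟨γ :: l', by simpa using ⟨hγ, hl'⟩, ?_, by simpa using hlen⟩
    rw [reflProd_cons, heq, reflProd_cons, ← mul_assoc, sref_mul_self, one_mul]

end IsRootSystem

lemma exists_reflProd_eq_of_mem_weylGroup {Δ : Set V} {w : V ≃ₗ[ℝ] V} (hw : w ∈ weylGroup Δ) :
    ∃ l : List V, (∀ γ ∈ l, γ ∈ Δ) ∧ reflProd l = w := by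
  induction hw using Subgroup.closure_induction'' with
  | one => exact ⟨[], by simp, rfl⟩
  | mem g hg =>
    obtain ⟨γ, hγ, rfl⟩ := hg
    exact ⟨[γ], by simpa using hγ, by simp [reflProd]⟩
  | inv_mem g hg =>
    obtain ⟨γ, hγ, rfl⟩ := hg
    exact ⟨[γ], by simpa using hγ, by simp [reflProd, sref_inv]⟩
  | mul g h _ _ hg hh =>
    obtain ⟨l₁, h₁, rfl⟩ := hg
    obtain ⟨l₂, h₂, rfl⟩ := hh
    exact ⟨l₁ ++ l₂, fun γ hγ => (List.mem_append.mp hγ).elim (h₁ γ) (h₂ γ),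
      reflProd_append l₁ l₂⟩

theorem statement2 {Δ : Set V} (hΔ : IsRootSystem Δ) (w : V ≃ₗ[ℝ] V)
    (hw : w ∈ weylGroup Δ) :
    reflLength Δ w =
      finrank ℝ V - finrank ℝ (LinearMap.ker ((↑w : V →ₗ[ℝ] V) - 1)) := by
  obtain ⟨l, hl, rfl⟩ := exists_reflProd_eq_of_mem_weylGroup hw
  have hker := Submodule.finrank_le (LinearMap.ker ((↑(reflProd l) : V →ₗ[ℝ] V) - 1))
  obtain ⟨l', hl', heq, hlen⟩ := hΔ.exists_reflProd_eq_length_add_finrank_le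
    (finrank ℝ V - finrank ℝ (LinearMap.ker ((↑(reflProd l) : V →ₗ[ℝ] V) - 1))) l hl (by omega)
  have hmem : l'.length ∈ {r | ∃ γ : Fin r → V, (∀ i, γ i ∈ Δ) ∧
      reflProd l = (List.ofFn fun i => sref (γ i)).prod} := by
    refine ⟨l'.get, fun i => hl' _ (l'.get_mem i), ?_⟩
    rw [← heq, reflProd]
    congr 1
    conv_lhs => rw [← List.ofFn_get l', List.map_ofFn]
    rfl
  refine le_antisymm ((Nat.sInf_le hmem).trans hlen) (le_csInf ⟨_, hmem⟩ ?_)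
  rintro r ⟨γ, -, hr⟩
  have hγ : reflProd (List.ofFn γ) = reflProd l := by
    rw [hr, reflProd, List.map_ofFn]
    rfl
  have hrange := finrank_range_reflProd_sub_one_le (List.ofFn γ)
  rw [hγ, List.length_ofFn] at hrange
  have hrn := LinearMap.finrank_range_add_finrank_ker ((↑(reflProd l) : V →ₗ[ℝ] V) - 1)
  omega
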